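/- arXiv:1706.02199 — 2 statements merged into one kernel-verified Lean document; each statement's English description precedes it below -/
import Mathlib

section
/- The Bindini–De Pascale regularization preserves the one-particle marginal: for almost every x₁ ∈ ℝ^d, ∫_{(ℝ^d)^{N−1}} P_ε(x₁, x₂, …, x_N) dx₂ ⋯ dx_N = ρ_P(x₁). -/
open MeasureTheory Real

noncomputable section

/-- `ℝ^d` as a Euclidean space. -/
abbrev Euc (d : ℕ) := EuclideanSpace ℝ (Fin d)

/-- Rescaled mollifier `χ_ε(x) = ε^{-d/2} χ(x/ε)`. -/
def chiE (d : ℕ) (χ : Euc d → ℝ) (ε : ℝ) (x : Euc d) : ℝ :=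
  ε ^ (-(d : ℝ) / 2) * χ (ε⁻¹ • x)

/-- Convolution `(ρ ∗ g²)(z) = ∫ ρ(x) g(z - x)² dx`. -/
def convSq (d : ℕ) (ρ : Euc d → ℝ) (g : Euc d → ℝ) (z : Euc d) : ℝ :=
  ∫ x : Euc d, ρ x * (g (z - x)) ^ 2

/-- The Bindini–De Pascale regularization `P_ε` (division by zero is `0` in Lean,
matching the convention that quotients with zero denominator are interpreted as `0`). -/
def Peps (d N : ℕ) (χ : Euc d → ℝ) (ε : ℝ) (ρ : Euc d → ℝ)
    (P : Measure (Fin N → Euc d)) (X : Fin N → Euc d) : ℝ :=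
  ∫ Z : Fin N → Euc d, ∫ Y : Fin N → Euc d,
    (∏ k, ρ (X k) * (chiE d χ ε (X k - Z k)) ^ 2 * (chiE d χ ε (Z k - Y k)) ^ 2
      / convSq d ρ (chiE d χ ε) (Z k)) ∂P

/-- The set `D^c_α` of configurations where all particles are at distance at least `α`. -/
def Dc (d N : ℕ) (α : ℝ) : Set (Fin N → Euc d) :=
  {X | ∀ i j, i ≠ j → α ≤ ‖X i - X j‖}

/-- The gradient of `Φ` with respect to the `j`-th `ℝ^d` coordinate block. -/
def blockGrad (d N : ℕ) (Φ : (Fin N → Euc d) → ℝ) (j : Fin N) (X : Fin N → Euc d) : Euc d :=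
  gradient (fun v => Φ (Function.update X j v)) (X j)

/-- The second derivative `∇_j ∇_k Φ`, as a continuous linear map on `ℝ^d`. -/
def blockGrad2 (d N : ℕ) (Φ : (Fin N → Euc d) → ℝ) (j k : Fin N) (X : Fin N → Euc d) :
    Euc d →L[ℝ] Euc d :=
  fderiv ℝ (fun w => blockGrad d N Φ j (Function.update X k w)) (X k)

/-- The lower Lebesgue integral of a product of functions of separate variables is the product of
the integrals. -/
theorem lintegral_pi_prod {E : Type*} [MeasurableSpace E] (μ : Measure E) [SigmaFinite μ]
    (n : ℕ) (f : Fin n → E → ENNReal) (hf : ∀ i, Measurable (f i)) :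
    ∫⁻ x : Fin n → E, ∏ i, f i (x i) ∂(Measure.pi fun _ => μ) = ∏ i, ∫⁻ x, f i x ∂μ := by
  induction n with
  | zero => simp
  | succ n ih =>
    have hmp := (measurePreserving_piFinSuccAbove (fun _ : Fin (n + 1) => μ) 0).symm
    rw [← hmp.lintegral_comp_emb (MeasurableEquiv.measurableEmbedding _)]
    simp only [MeasurableEquiv.piFinSuccAbove_symm_apply, Fin.prod_univ_succ,
      Fin.insertNthEquiv_apply, Fin.insertNth_zero, Fin.cons_zero, Fin.cons_succ]
    rw [← ih (fun i => f i.succ) fun i => hf i.succ]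
    exact lintegral_prod_mul (hf 0).aemeasurable
      (Finset.measurable_fun_prod _ fun (i : Fin n) _ =>
        (hf i.succ).comp (measurable_pi_apply i)).aemeasurable

theorem measurable_fin_cons {E : Type*} [MeasurableSpace E] {n : ℕ} (x : E) :
    Measurable fun r : Fin n → E => (Fin.cons x r : Fin (n + 1) → E) :=
  measurable_pi_lambda _ fun i => by
    refine Fin.cases ?_ (fun j => ?_) i
    · simp
    · simpa using measurable_pi_apply j

section Regularization

variable {E : Type*} [MeasurableSpace E] {μ : Measure E} [SigmaFinite μ]
  {A : E → ENNReal} {k : E → E → ENNReal} {W : E → ENNReal}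

open Function

/-- For a probability kernel `k`, the integral of `k z y` over the zero set of
`∫ A x * k x z` vanishes for almost every `y` with respect to the density `A`. -/
theorem ae_lintegral_kernel_mul_mass_eq_one (hA : Measurable A) (hk : Measurable (uncurry k))
    (hk_symm : ∀ x y, k x y = k y x) (hk_one : ∀ x, ∫⁻ z, k x z ∂μ = 1)
    (hW : ∀ z, W z * ∫⁻ x, A x * k x z ∂μ = if ∫⁻ x, A x * k x z ∂μ = 0 then 0 else 1) :
    ∀ᵐ y ∂(μ.withDensity A), ∫⁻ z, k z y * (W z * ∫⁻ x, A x * k x z ∂μ) ∂μ = 1 := by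
  rw [ae_withDensity_iff hA]
  have hmeas : Measurable (uncurry fun x z => A x * k x z) := (hA.comp measurable_fst).mul hk
  have hmeas' : Measurable (uncurry fun z x => A x * k x z) := hmeas.comp measurable_swap
  have hC : Measurable fun z => ∫⁻ x, A x * k x z ∂μ := hmeas'.lintegral_prod_right
  set C := fun z => ∫⁻ x, A x * k x z ∂μ
  have hS : MeasurableSet {z | C z = 0} := hC (measurableSet_singleton 0)
  have hzero : ∀ᵐ z ∂μ.restrict {z | C z = 0}, ∀ᵐ x ∂μ, A x * k x z = 0 := by
    filter_upwards [ae_restrict_mem hS] with z hz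
    have hz' : ∫⁻ x, A x * k x z ∂μ = 0 := hz
    exact (lintegral_eq_zero_iff (hmeas'.comp measurable_prodMk_left)).1 hz'
  have hswap : ∀ᵐ y ∂μ, ∀ᵐ z ∂μ.restrict {z | C z = 0}, A y * k y z = 0 :=
    (Measure.ae_ae_comm (p := fun z x => A x * k x z = 0)
      (hmeas' (measurableSet_singleton 0))).1 hzero
  filter_upwards [hswap] with y hy hAy
  rw [ae_restrict_iff' hS] at hy
  rw [← hk_one y]
  refine lintegral_congr_ae ?_
  filter_upwards [hy] with z hz
  rw [hW z, hk_symm z y]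
  split_ifs with h
  · rcases mul_eq_zero.1 (hz h) with h' | h'
    · exact absurd h' hAy
    · simp [h']
  · simp

/-- One-particle marginal of a regularized measure, for a general symmetric probability kernel. -/
theorem lintegral_regularization (hA : Measurable A) (hk : Measurable (uncurry k))
    (hWm : Measurable W)
    (hk_symm : ∀ x y, k x y = k y x) (hk_one : ∀ x, ∫⁻ z, k x z ∂μ = 1)
    (hW : ∀ z, W z * ∫⁻ x, A x * k x z ∂μ = if ∫⁻ x, A x * k x z ∂μ = 0 then 0 else 1)
    {n : ℕ} (P : Measure (Fin (n + 1) → E)) [IsProbabilityMeasure P]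
    (hP : ∀ i, P.map (fun X => X i) = μ.withDensity A) :
    ∀ᵐ x ∂μ,
      ∫⁻ r : Fin n → E, ∫⁻ Z : Fin (n + 1) → E, ∫⁻ Y,
        (∏ i, A ((Fin.cons x r : Fin (n + 1) → E) i) * k ((Fin.cons x r : Fin (n + 1) → E) i) (Z i)
          * k (Z i) (Y i) * W (Z i)) ∂P ∂(Measure.pi fun _ => μ) ∂(Measure.pi fun _ => μ)
        = A x := by
  have hmass := ae_lintegral_kernel_mul_mass_eq_one hA hk hk_symm hk_one hW
  have hmass' : ∀ᵐ x ∂μ, A x * ∫⁻ z, k z x * (W z * ∫⁻ x, A x * k x z ∂μ) ∂μ = A x := by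
    rw [ae_withDensity_iff hA] at hmass
    filter_upwards [hmass] with x hx
    by_cases h : A x = 0
    · simp [h]
    · rw [hx h, mul_one]
  have hmassP : ∀ᵐ Y ∂P, ∀ i, ∫⁻ z, k z (Y i) * (W z * ∫⁻ x, A x * k x z ∂μ) ∂μ = 1 := by
    refine ae_all_iff.2 fun i => ?_
    rw [← hP i] at hmass
    exact ae_of_ae_map (measurable_pi_apply i).aemeasurable hmass
  have hkc : ∀ {T : Type _} [MeasurableSpace T] {f g : T → E}, Measurable f → Measurable g →
      Measurable fun t => k (f t) (g t) := fun hf hg => hk.comp (hf.prodMk hg)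
  have hF : ∀ {T : Type _} [MeasurableSpace T] {f g h : T → E}, Measurable f → Measurable g →
      Measurable h → Measurable fun t => A (f t) * k (f t) (g t) * k (g t) (h t) * W (g t) :=
    fun hf hg hh => (((hA.comp hf).mul (hkc hf hg)).mul (hkc hg hh)).mul (hWm.comp hg)
  have hC : Measurable fun z => ∫⁻ x, A x * k x z ∂μ :=
    Measurable.lintegral_prod_right
      (f := fun z x => A x * k x z) ((hA.comp measurable_snd).mul (hkc measurable_snd measurable_fst))
  filter_upwards [hmass'] with x hx
  have hcons := measurable_fin_cons (n := n) x
  have hAk : ∀ z, Measurable fun x => A x * k x z := fun z =>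
    hA.mul (hkc measurable_id measurable_const)
  set C := fun z => ∫⁻ x, A x * k x z ∂μ with hCdef
  let F : E → E → E → ENNReal := fun x z y => A x * k x z * k z y * W z
  let K : E → E → ENNReal := fun z y => k z y * (W z * C z)
  have hFK : ∀ z y, ∫⁻ x, F x z y ∂μ = K z y := fun z y => by
    have : ∀ x, F x z y = k z y * W z * (A x * k x z) := fun x => by simp only [F]; ring
    simp only [this, K, hCdef]
    rw [lintegral_const_mul _ (hAk z), mul_assoc]
  have hKc : ∀ {T : Type _} [MeasurableSpace T] {f g : T → E}, Measurable f → Measurable g →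
      Measurable fun t => K (f t) (g t) := fun hf hg =>
    (hkc hf hg).mul ((hWm.comp hf).mul (hC.comp hf))
  have hprod : ∀ {T : Type _} [MeasurableSpace T] {f : T → Fin n → E} {g h : T → Fin (n + 1) → E},
      Measurable f → Measurable g → Measurable h → Measurable fun t =>
        ∏ i, F ((Fin.cons x (f t) : Fin (n + 1) → E) i) (g t i) (h t i) := fun hf hg hh =>
    Finset.measurable_fun_prod _ fun i _ => hF ((measurable_pi_apply i).comp (hcons.comp hf))
      ((measurable_pi_apply i).comp hg) ((measurable_pi_apply i).comp hh)
  calc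
    _ = ∫⁻ Z : Fin (n + 1) → E, ∫⁻ r : Fin n → E, ∫⁻ Y,
          (∏ i, F ((Fin.cons x r : Fin (n + 1) → E) i) (Z i) (Y i)) ∂P
          ∂(Measure.pi fun _ => μ) ∂(Measure.pi fun _ => μ) := by
      refine lintegral_lintegral_swap (Measurable.aemeasurable ?_)
      exact Measurable.lintegral_prod_right (hprod (measurable_fst.comp measurable_fst)
        (measurable_snd.comp measurable_fst) measurable_snd)
    _ = ∫⁻ Z : Fin (n + 1) → E, ∫⁻ Y, ∫⁻ r : Fin n → E,
          (∏ i, F ((Fin.cons x r : Fin (n + 1) → E) i) (Z i) (Y i))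
          ∂(Measure.pi fun _ => μ) ∂P ∂(Measure.pi fun _ => μ) :=
      lintegral_congr fun Z => lintegral_lintegral_swap
        (hprod measurable_fst measurable_const measurable_snd).aemeasurable
    _ = ∫⁻ Z : Fin (n + 1) → E, ∫⁻ Y, F x (Z 0) (Y 0) * ∏ i : Fin n, K (Z i.succ) (Y i.succ)
          ∂P ∂(Measure.pi fun _ => μ) := by
      refine lintegral_congr fun Z => lintegral_congr fun Y => ?_
      simp only [Fin.prod_univ_succ, Fin.cons_zero, Fin.cons_succ, ← hFK]
      rw [lintegral_const_mul _ (Finset.measurable_fun_prod _ fun i _ =>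
        hF (measurable_pi_apply i) measurable_const measurable_const),
        lintegral_pi_prod μ n (fun (i : Fin n) x => F x (Z i.succ) (Y i.succ)) fun i =>
          hF measurable_id measurable_const measurable_const]
    _ = ∫⁻ Y, ∫⁻ Z : Fin (n + 1) → E, F x (Z 0) (Y 0) * ∏ i : Fin n, K (Z i.succ) (Y i.succ)
          ∂(Measure.pi fun _ => μ) ∂P := by
      refine lintegral_lintegral_swap (Measurable.aemeasurable ?_)
      have hfst : ∀ i, Measurable fun p : (Fin (n + 1) → E) × (Fin (n + 1) → E) => p.1 i :=
        fun i => (measurable_pi_apply i).comp measurable_fst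
      have hsnd : ∀ i, Measurable fun p : (Fin (n + 1) → E) × (Fin (n + 1) → E) => p.2 i :=
        fun i => (measurable_pi_apply i).comp measurable_snd
      exact (hF measurable_const (hfst 0) (hsnd 0)).mul
        (Finset.measurable_fun_prod _ fun i _ => hKc (hfst i.succ) (hsnd i.succ))
    _ = ∫⁻ Y, ∫⁻ z, F x z (Y 0) ∂μ ∂P := by
      refine lintegral_congr_ae ?_
      filter_upwards [hmassP] with Y hY
      have := lintegral_pi_prod μ (n + 1)
        (Fin.cons (fun z => F x z (Y 0)) fun (i : Fin n) z => K z (Y i.succ)) (by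
          refine Fin.cases ?_ fun i => ?_
          · exact hF measurable_const measurable_id measurable_const
          · exact hKc measurable_id measurable_const)
      simp only [Fin.prod_univ_succ, Fin.cons_zero, Fin.cons_succ] at this
      rw [this, Finset.prod_eq_one fun i _ => hY i.succ, mul_one]
    _ = ∫⁻ y, ∫⁻ z, F x z y ∂μ ∂(μ.withDensity A) := by
      rw [← hP 0]
      refine (lintegral_map (f := fun y => ∫⁻ z, F x z y ∂μ) ?_
        (measurable_pi_apply (0 : Fin (n + 1)))).symm
      exact Measurable.lintegral_prod_right (hF measurable_const measurable_snd measurable_fst)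
    _ = ∫⁻ y, ∫⁻ z, A y * F x z y ∂μ ∂μ := by
      rw [lintegral_withDensity_eq_lintegral_mul _ hA
        (Measurable.lintegral_prod_right (hF measurable_const measurable_snd measurable_fst))]
      exact lintegral_congr fun y => (lintegral_const_mul _
        (hF measurable_const measurable_id measurable_const)).symm
    _ = ∫⁻ z, ∫⁻ y, A y * F x z y ∂μ ∂μ := lintegral_lintegral_swap
      ((hA.comp measurable_fst).mul
        (hF measurable_const measurable_snd measurable_fst)).aemeasurable
    _ = ∫⁻ z, A x * K z x ∂μ := by
      refine lintegral_congr fun z => ?_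
      have : ∀ y, A y * F x z y = A x * k z x * W z * (A y * k y z) := fun y => by
        simp only [F, hk_symm x z, hk_symm z y]; ring
      simp only [this, K, hCdef]
      rw [lintegral_const_mul _ (hAk z)]
      ring
    _ = A x := by
      have hKx : Measurable fun z => K z x := hKc measurable_id measurable_const
      rw [lintegral_const_mul _ hKx]
      exact hx

end Regularization

theorem chiE_neg {d : ℕ} {χ : Euc d → ℝ} (hχ : ∀ x y : Euc d, ‖x‖ = ‖y‖ → χ x = χ y) (ε : ℝ)
    (x : Euc d) : chiE d χ ε (-x) = chiE d χ ε x := by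
  unfold chiE
  rw [hχ (ε⁻¹ • -x) (ε⁻¹ • x) (by rw [smul_neg, norm_neg])]

theorem continuous_chiE {d : ℕ} {χ : Euc d → ℝ} (hχ : Continuous χ) (ε : ℝ) :
    Continuous (chiE d χ ε) := by
  unfold chiE
  fun_prop

theorem integral_chiE_sq {d : ℕ} {χ : Euc d → ℝ} (hχ : ∫ x : Euc d, χ x ^ 2 = 1) {ε : ℝ}
    (hε : 0 < ε) : ∫ x : Euc d, chiE d χ ε x ^ 2 = 1 := by
  simp only [chiE, mul_pow]
  rw [integral_const_mul, Measure.integral_comp_inv_smul_of_nonneg volume (fun x => χ x ^ 2) hε.le,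
    hχ, finrank_euclideanSpace_fin, smul_eq_mul, mul_one, ← Real.rpow_natCast, ← Real.rpow_natCast,
    ← Real.rpow_mul hε.le, ← Real.rpow_add hε]
  norm_num

theorem lintegral_chiE_sq {d : ℕ} {χ : Euc d → ℝ} (hχ : ∫ x : Euc d, χ x ^ 2 = 1) {ε : ℝ}
    (hε : 0 < ε) : ∫⁻ x : Euc d, ENNReal.ofReal (chiE d χ ε x ^ 2) = 1 := by
  have h := integral_chiE_sq hχ hε
  rw [← ofReal_integral_eq_lintegral_ofReal (.of_integral_ne_zero (by rw [h]; exact one_ne_zero))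
    (ae_of_all _ fun x => sq_nonneg _), h, ENNReal.ofReal_one]

theorem exists_chiE_sq_le {d : ℕ} {χ : Euc d → ℝ} (hχ : Continuous χ)
    (hsupp : Function.support χ ⊆ Metric.closedBall 0 1) (ε : ℝ) :
    ∃ M : ℝ, ∀ x, chiE d χ ε x ^ 2 ≤ M := by
  obtain ⟨B, hB⟩ := (HasCompactSupport.of_support_subset_isCompact
    (isCompact_closedBall (0 : Euc d) 1) hsupp).exists_bound_of_continuous hχ
  refine ⟨(ε ^ (-(d : ℝ) / 2)) ^ 2 * B ^ 2, fun x => ?_⟩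
  rw [chiE, mul_pow]
  have h := abs_le.1 (hB (ε⁻¹ • x))
  exact mul_le_mul_of_nonneg_left (sq_le_sq' h.1 h.2) (sq_nonneg _)

/-- The convolution `ρ ∗ g²` agrees with its `ENNReal`-valued counterpart. -/
theorem ofReal_convSq_chiE {d : ℕ} {χ : Euc d → ℝ} (hχ : Continuous χ)
    (hsupp : Function.support χ ⊆ Metric.closedBall 0 1)
    (hradial : ∀ x y : Euc d, ‖x‖ = ‖y‖ → χ x = χ y) (ε : ℝ) {ρ : Euc d → ℝ}
    (hρ_nonneg : ∀ x, 0 ≤ ρ x) (hρ_meas : Measurable ρ)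
    (hρ_fin : ∫⁻ x, ENNReal.ofReal (ρ x) ≠ ⊤) (z : Euc d) :
    ENNReal.ofReal (convSq d ρ (chiE d χ ε) z)
      = ∫⁻ x, ENNReal.ofReal (ρ x) * ENNReal.ofReal (chiE d χ ε (x - z) ^ 2) := by
  obtain ⟨M, hM⟩ := exists_chiE_sq_le hχ hsupp ε
  have hcont := continuous_chiE hχ ε
  have hmeas : Measurable fun x => ρ x * chiE d χ ε (z - x) ^ 2 :=
    hρ_meas.mul (by fun_prop : Continuous fun x => chiE d χ ε (z - x) ^ 2).measurable
  have heq : ∀ x, ENNReal.ofReal (ρ x * chiE d χ ε (z - x) ^ 2)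
      = ENNReal.ofReal (ρ x) * ENNReal.ofReal (chiE d χ ε (x - z) ^ 2) := fun x => by
    rw [ENNReal.ofReal_mul (hρ_nonneg x), ← neg_sub x z, chiE_neg hradial]
  unfold convSq
  rw [integral_eq_lintegral_of_nonneg_ae
    (ae_of_all _ fun x => mul_nonneg (hρ_nonneg x) (sq_nonneg _)) hmeas.aestronglyMeasurable]
  simp only [heq]
  refine ENNReal.ofReal_toReal (ne_top_of_le_ne_top
    (ENNReal.mul_ne_top hρ_fin (ENNReal.ofReal_ne_top (r := M))) ?_)
  rw [← lintegral_mul_const _ hρ_meas.ennreal_ofReal]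
  gcongr
  exact hM _

/-- The `ENNReal`-valued counterpart of the integrand of `Peps`. -/
def pepsIntegrand (d N : ℕ) (χ : Euc d → ℝ) (ε : ℝ) (ρ : Euc d → ℝ) (X Z Y : Fin N → Euc d) :
    ENNReal :=
  ∏ i, ENNReal.ofReal (ρ (X i)) * ENNReal.ofReal (chiE d χ ε (X i - Z i) ^ 2)
    * ENNReal.ofReal (chiE d χ ε (Z i - Y i) ^ 2)
    * ENNReal.ofReal (convSq d ρ (chiE d χ ε) (Z i))⁻¹

theorem measurable_pepsIntegrand {d N : ℕ} {χ : Euc d → ℝ} (hχ : Continuous χ) {ε : ℝ}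
    {ρ : Euc d → ℝ} (hρ : Measurable ρ) (hc : Measurable (convSq d ρ (chiE d χ ε)))
    {T : Type*} [MeasurableSpace T] {X Z Y : T → Fin N → Euc d}
    (hX : Measurable X) (hZ : Measurable Z) (hY : Measurable Y) :
    Measurable fun t => pepsIntegrand d N χ ε ρ (X t) (Z t) (Y t) := by
  have hg := (continuous_chiE hχ ε).measurable
  have hX' : ∀ i, Measurable fun t => X t i := fun i => (measurable_pi_apply i).comp hX
  have hZ' : ∀ i, Measurable fun t => Z t i := fun i => (measurable_pi_apply i).comp hZ
  have hY' : ∀ i, Measurable fun t => Y t i := fun i => (measurable_pi_apply i).comp hY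
  exact Finset.measurable_fun_prod _ fun i _ =>
    (((hρ.comp (hX' i)).ennreal_ofReal.mul
      ((hg.comp ((hX' i).sub (hZ' i))).pow_const 2).ennreal_ofReal).mul
      ((hg.comp ((hZ' i).sub (hY' i))).pow_const 2).ennreal_ofReal).mul
      (hc.comp (hZ' i)).inv.ennreal_ofReal

theorem lintegral_pepsIntegrand_lt_top {d N : ℕ} {χ : Euc d → ℝ} (hχ : Continuous χ)
    (hsupp : Function.support χ ⊆ Metric.closedBall 0 1) (ε : ℝ) (ρ : Euc d → ℝ)
    (P : Measure (Fin N → Euc d)) [IsProbabilityMeasure P] (X Z : Fin N → Euc d) :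
    ∫⁻ Y, pepsIntegrand d N χ ε ρ X Z Y ∂P < ⊤ := by
  obtain ⟨M, hM⟩ := exists_chiE_sq_le hχ hsupp ε
  refine lt_of_le_of_lt (lintegral_mono (g := fun _ => ∏ i,
    ENNReal.ofReal (ρ (X i)) * ENNReal.ofReal M * ENNReal.ofReal M
      * ENNReal.ofReal (convSq d ρ (chiE d χ ε) (Z i))⁻¹) fun Y => ?_) ?_
  · refine Finset.prod_le_prod' fun i _ => ?_
    gcongr
    · exact hM _
    · exact hM _
  · rw [lintegral_const, measure_univ, mul_one]
    exact ENNReal.prod_lt_top fun i _ => ENNReal.mul_lt_top (ENNReal.mul_lt_top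
      (ENNReal.mul_lt_top ENNReal.ofReal_lt_top ENNReal.ofReal_lt_top) ENNReal.ofReal_lt_top)
      ENNReal.ofReal_lt_top

theorem toReal_pepsIntegrand {d N : ℕ} (χ : Euc d → ℝ) (ε : ℝ) {ρ : Euc d → ℝ}
    (hρ_nonneg : ∀ x, 0 ≤ ρ x) (X Z Y : Fin N → Euc d) :
    (pepsIntegrand d N χ ε ρ X Z Y).toReal
      = ∏ k, ρ (X k) * (chiE d χ ε (X k - Z k)) ^ 2 * (chiE d χ ε (Z k - Y k)) ^ 2
        / convSq d ρ (chiE d χ ε) (Z k) := by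
  have hc_nonneg : ∀ z, 0 ≤ convSq d ρ (chiE d χ ε) z := fun z =>
    integral_nonneg fun x => mul_nonneg (hρ_nonneg x) (sq_nonneg _)
  rw [pepsIntegrand, ENNReal.toReal_prod]
  refine Finset.prod_congr rfl fun k _ => ?_
  rw [ENNReal.toReal_mul, ENNReal.toReal_mul, ENNReal.toReal_mul,
    ENNReal.toReal_ofReal (hρ_nonneg _), ENNReal.toReal_ofReal (sq_nonneg _),
    ENNReal.toReal_ofReal (sq_nonneg _), ENNReal.toReal_ofReal (inv_nonneg.2 (hc_nonneg _)),
    div_eq_mul_inv]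

theorem Peps_eq_toReal_lintegral {d N : ℕ} {χ : Euc d → ℝ} (hχ : Continuous χ)
    (hsupp : Function.support χ ⊆ Metric.closedBall 0 1) {ε : ℝ} {ρ : Euc d → ℝ}
    (hρ_nonneg : ∀ x, 0 ≤ ρ x) (hρ_meas : Measurable ρ)
    (hc : Measurable (convSq d ρ (chiE d χ ε)))
    (P : Measure (Fin N → Euc d)) [IsProbabilityMeasure P] (X : Fin N → Euc d) :
    Peps d N χ ε ρ P X = (∫⁻ Z, ∫⁻ Y, pepsIntegrand d N χ ε ρ X Z Y ∂P).toReal := by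
  have hI : Measurable fun p : (Fin N → Euc d) × (Fin N → Euc d) =>
      pepsIntegrand d N χ ε ρ X p.1 p.2 :=
    measurable_pepsIntegrand hχ hρ_meas hc measurable_const measurable_fst measurable_snd
  have hfin := lintegral_pepsIntegrand_lt_top hχ hsupp ε ρ P X
  unfold Peps
  simp only [← toReal_pepsIntegrand χ ε hρ_nonneg]
  have hinner : ∀ Z, ∫ Y, (pepsIntegrand d N χ ε ρ X Z Y).toReal ∂P
      = (∫⁻ Y, pepsIntegrand d N χ ε ρ X Z Y ∂P).toReal := fun Z => by
    have hm : Measurable fun Y => pepsIntegrand d N χ ε ρ X Z Y :=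
      measurable_pepsIntegrand hχ hρ_meas hc measurable_const measurable_const measurable_id
    exact integral_toReal hm.aemeasurable (ae_lt_top hm (hfin Z).ne)
  simp only [hinner]
  exact integral_toReal hI.lintegral_prod_right'.aemeasurable (ae_of_all _ hfin)

/-- the Bindini–De Pascale regularization preserves the one-particle
marginal: for a.e. `x₁`, `∫ P_ε(x₁, x₂, …, x_N) dx₂ ⋯ dx_N = ρ_P(x₁)` (here `N = n + 1`). -/
theorem bindiniDePascale_marginal
    (d n : ℕ) (hd : 1 ≤ d) (hN : 2 ≤ n + 1)
    (χ : Euc d → ℝ) (hχ_smooth : ContDiff ℝ (⊤ : ℕ∞) χ)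
    (hχ_supp : Function.support χ ⊆ Metric.closedBall 0 1)
    (hχ_radial : ∀ x y : Euc d, ‖x‖ = ‖y‖ → χ x = χ y)
    (hχ_norm : ∫ x : Euc d, (χ x) ^ 2 = 1)
    (ε : ℝ) (hε : 0 < ε)
    (P : Measure (Fin (n + 1) → Euc d)) [IsProbabilityMeasure P]
    (hP_symm : ∀ σ : Equiv.Perm (Fin (n + 1)), P.map (fun X => X ∘ σ) = P)
    (ρ : Euc d → ℝ) (hρ_nonneg : ∀ x, 0 ≤ ρ x) (hρ_meas : Measurable ρ)
    (hP_marginal : P.map (fun X => X (⟨0, by omega⟩ : Fin (n + 1)))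
      = volume.withDensity (fun x => ENNReal.ofReal (ρ x)))
 :
    ∀ᵐ x₁ : Euc d,
      ∫ rest : Fin n → Euc d,
        Peps d (n + 1) χ ε ρ P (Fin.cons x₁ rest) = ρ x₁ := by
  
  have hχ := hχ_smooth.continuous
  have hcont := continuous_chiE hχ ε
  have hP : ∀ i, P.map (fun X => X i) = volume.withDensity fun x => ENNReal.ofReal (ρ x) := by
    intro i
    rw [← hP_marginal]
    have hσ : Measurable fun X : Fin (n + 1) → Euc d => X ∘ Equiv.swap 0 i :=
      measurable_pi_lambda _ fun j => measurable_pi_apply _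
    conv_rhs => rw [← hP_symm (Equiv.swap 0 i)]
    rw [Measure.map_map (measurable_pi_apply _) hσ]
    exact congrArg (P.map ·) (funext fun X => congrArg X (Equiv.swap_apply_left 0 i).symm)
  have hρ_fin : ∫⁻ x, ENNReal.ofReal (ρ x) ≠ ⊤ := by
    have h : P.map (fun X => X 0) Set.univ = 1 := by
      rw [Measure.map_apply (measurable_pi_apply _) .univ, Set.preimage_univ, measure_univ]
    rw [hP 0, withDensity_apply _ .univ, setLIntegral_univ] at h
    rw [h]
    exact ENNReal.one_ne_top
  have hA : Measurable fun x => ENNReal.ofReal (ρ x) := hρ_meas.ennreal_ofReal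
  have hk : Measurable (Function.uncurry fun x z : Euc d =>
      ENNReal.ofReal (chiE d χ ε (x - z) ^ 2)) := by
    have hg := hcont.measurable
    unfold Function.uncurry
    fun_prop
  have hk_symm : ∀ x y : Euc d, ENNReal.ofReal (chiE d χ ε (x - y) ^ 2)
      = ENNReal.ofReal (chiE d χ ε (y - x) ^ 2) := fun x y => by
    rw [← neg_sub y x, chiE_neg hχ_radial]
  have hk_one : ∀ x : Euc d, ∫⁻ z, ENNReal.ofReal (chiE d χ ε (x - z) ^ 2) = 1 := fun x => by
    rw [lintegral_sub_left_eq_self (fun z => ENNReal.ofReal (chiE d χ ε z ^ 2)) x]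
    exact lintegral_chiE_sq hχ_norm hε
  have hconv := ofReal_convSq_chiE hχ hχ_supp hχ_radial ε hρ_nonneg hρ_meas hρ_fin
  have hc_nonneg : ∀ z, 0 ≤ convSq d ρ (chiE d χ ε) z := fun z =>
    integral_nonneg fun x => mul_nonneg (hρ_nonneg x) (sq_nonneg _)
  have hc : Measurable (convSq d ρ (chiE d χ ε)) := by
    have h : convSq d ρ (chiE d χ ε) = fun z =>
        (∫⁻ x, ENNReal.ofReal (ρ x) * ENNReal.ofReal (chiE d χ ε (x - z) ^ 2)).toReal := by
      funext z
      rw [← hconv, ENNReal.toReal_ofReal (hc_nonneg z)]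
    rw [h]
    have hm : Measurable fun p : Euc d × Euc d =>
        ENNReal.ofReal (ρ p.2) * ENNReal.ofReal (chiE d χ ε (p.2 - p.1) ^ 2) :=
      (hA.comp measurable_snd).mul
        ((hcont.measurable.comp (measurable_snd.sub measurable_fst)).pow_const 2).ennreal_ofReal
    exact hm.lintegral_prod_right'.ennreal_toReal
  have hW : ∀ z, ENNReal.ofReal (convSq d ρ (chiE d χ ε) z)⁻¹ *
      ∫⁻ x, ENNReal.ofReal (ρ x) * ENNReal.ofReal (chiE d χ ε (x - z) ^ 2)
      = if ∫⁻ x, ENNReal.ofReal (ρ x) * ENNReal.ofReal (chiE d χ ε (x - z) ^ 2) = 0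
        then 0 else 1 := fun z => by
    rw [← hconv, ← ENNReal.ofReal_mul (inv_nonneg.2 (hc_nonneg z))]
    split_ifs with h
    · rw [le_antisymm (ENNReal.ofReal_eq_zero.1 h) (hc_nonneg z), mul_zero, ENNReal.ofReal_zero]
    · rw [inv_mul_cancel₀ (fun h0 => h (by rw [h0, ENNReal.ofReal_zero])), ENNReal.ofReal_one]
  have hmain := lintegral_regularization (μ := volume)
    (k := fun x z => ENNReal.ofReal (chiE d χ ε (x - z) ^ 2))
    (W := fun z => ENNReal.ofReal (convSq d ρ (chiE d χ ε) z)⁻¹)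
    hA hk hc.inv.ennreal_ofReal hk_symm hk_one hW P hP
  filter_upwards [hmain] with x hx
  have hx' : ∫⁻ r : Fin n → Euc d, ∫⁻ Z, ∫⁻ Y,
      pepsIntegrand d (n + 1) χ ε ρ (Fin.cons x r) Z Y ∂P = ENNReal.ofReal (ρ x) := by
    simpa only [pepsIntegrand, volume_pi] using hx
  have hm : Measurable fun r : Fin n → Euc d => ∫⁻ Z, ∫⁻ Y,
      pepsIntegrand d (n + 1) χ ε ρ (Fin.cons x r) Z Y ∂P := by
    refine Measurable.lintegral_prod_right (f := fun r Z => ∫⁻ Y,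
      pepsIntegrand d (n + 1) χ ε ρ (Fin.cons x r) Z Y ∂P) ?_
    exact Measurable.lintegral_prod_right (measurable_pepsIntegrand hχ hρ_meas hc
      ((measurable_fin_cons x).comp (measurable_fst.comp measurable_fst))
      (measurable_snd.comp measurable_fst) measurable_snd)
  simp only [Peps_eq_toReal_lintegral hχ hχ_supp hρ_nonneg hρ_meas hc P]
  rw [integral_toReal hm.aemeasurable (ae_lt_top hm (by rw [hx']; exact ENNReal.ofReal_ne_top)),
    hx', ENNReal.toReal_ofReal (hρ_nonneg x)]
end
end

section
/- If the symmetric probability measure P is supported in D^c_α and 0 < ε < α/4, then the regularized density P_ε vanishes outside D^c_{α−4ε}; that is, P_ε(x₁,…,x_N) = 0 whenever |x_i − x_j| < α − 4ε for some pair i ≠ j. -/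
open MeasureTheory Real

noncomputable section

/-- The rescaled mollifier vanishes outside the closed ball of radius `ε`. -/
lemma norm_le_of_chiE_ne_zero {d : ℕ} {χ : Euc d → ℝ} {ε : ℝ} (hε : 0 < ε)
    (hχ : Function.support χ ⊆ Metric.closedBall 0 1) {x : Euc d} (hx : chiE d χ ε x ≠ 0) :
    ‖x‖ ≤ ε := by
  have h := hχ (Function.mem_support.2 (right_ne_zero_of_mul hx))
  rw [mem_closedBall_zero_iff, norm_smul, norm_inv, Real.norm_of_nonneg hε.le,
    inv_mul_le_iff₀ hε, mul_one] at h
  exact h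

/-- if `P` is supported in `D^c_α` and `0 < ε < α/4`, then `P_ε`
vanishes as soon as `‖x_i - x_j‖ < α - 4ε` for some pair `i ≠ j`. -/
theorem bindiniDePascale_support
    (d N : ℕ) (hd : 1 ≤ d) (hN : 2 ≤ N)
    (χ : Euc d → ℝ) (hχ_smooth : ContDiff ℝ (⊤ : ℕ∞) χ)
    (hχ_supp : Function.support χ ⊆ Metric.closedBall 0 1)
    (hχ_radial : ∀ x y : Euc d, ‖x‖ = ‖y‖ → χ x = χ y)
    (hχ_norm : ∫ x : Euc d, (χ x) ^ 2 = 1)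
    (α ε : ℝ) (hα : 0 < α) (hε : 0 < ε) (hεα : ε < α / 4)
    (P : Measure (Fin N → Euc d)) [IsProbabilityMeasure P]
    (hP_symm : ∀ σ : Equiv.Perm (Fin N), P.map (fun X => X ∘ σ) = P)
    (ρ : Euc d → ℝ) (hρ_nonneg : ∀ x, 0 ≤ ρ x) (hρ_meas : Measurable ρ)
    (hP_marginal : P.map (fun X => X (⟨0, by omega⟩ : Fin N))
      = volume.withDensity (fun x => ENNReal.ofReal (ρ x)))
    (hP_supp : ∀ᵐ Y ∂P, Y ∈ Dc d N α) :
    ∀ X : Fin N → Euc d, (∃ i j, i ≠ j ∧ ‖X i - X j‖ < α - 4 * ε) →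
      Peps d N χ ε ρ P X = 0 := by
  rintro X ⟨i, j, hij, hX⟩
  refine integral_eq_zero_of_ae (Filter.Eventually.of_forall fun Z => ?_)
  refine integral_eq_zero_of_ae (hP_supp.mono fun Y hY => ?_)
  by_contra hne
  have hclose (k : Fin N) : ‖X k - Y k‖ ≤ 2 * ε := by
    have hk := Finset.prod_ne_zero_iff.1 hne k (Finset.mem_univ k)
    simp only [ne_eq, div_eq_zero_iff, mul_eq_zero, pow_eq_zero_iff two_ne_zero, not_or] at hk
    have h₁ := norm_le_of_chiE_ne_zero hε hχ_supp hk.1.1.2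
    have h₂ := norm_le_of_chiE_ne_zero hε hχ_supp hk.1.2
    linarith [norm_sub_le_norm_sub_add_norm_sub (X k) (Z k) (Y k)]
  have hdist := hY i j hij
  have htri₁ := norm_sub_le_norm_sub_add_norm_sub (Y i) (X i) (Y j)
  have htri₂ := norm_sub_le_norm_sub_add_norm_sub (X i) (X j) (Y j)
  have hi := hclose i
  rw [norm_sub_rev] at hi
  linarith [hclose j]
end
end
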